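/- arXiv:1707.07236 — 3 statements merged into one kernel-verified Lean document; each statement's English description precedes it below -/
import Mathlib

section
/- Let n ≥ 3 and let T be a nonzero real symmetric n×n matrix with tr(T) = 0 whose trace of cube attains the extremal value tr(T³) = −((n−2)/√(n(n−1))) · ‖T‖³, where ‖T‖ is the Frobenius norm. Then T has exactly two distinct eigenvalues: one eigenvalue a > 0 of multiplicity n−1 and the eigenvalue −(n−1)a of multiplicity 1. -/
namespace Matrix.IsHermitian

variable {ι : Type*} [Fintype ι] [DecidableEq ι] {A : Matrix ι ι ℝ}

theorem trace_pow_eq_sum_eigenvalues_pow (hA : A.IsHermitian) (k : ℕ) :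
    (A ^ k).trace = ∑ i, hA.eigenvalues i ^ k := by
  conv_lhs => rw [hA.spectral_theorem, ← map_pow, Unitary.conjStarAlgAut_apply, trace_mul_cycle,
    Unitary.coe_star_mul_self, one_mul, diagonal_pow]
  simp [trace_diagonal]

theorem finrank_eigenspace_toLin' (hA : A.IsHermitian) (μ : ℝ) :
    Module.finrank ℝ (Module.End.eigenspace (toLin' A) μ) =
      Finset.card {i | hA.eigenvalues i = μ} := by
  have hconj : A - μ • 1 = Unitary.conjStarAlgAut ℝ _ hA.eigenvectorUnitary
      (diagonal fun i => hA.eigenvalues i - μ) := by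
    have hdiag : (diagonal fun i => hA.eigenvalues i - μ) =
        diagonal (RCLike.ofReal ∘ hA.eigenvalues) - μ • (1 : Matrix ι ι ℝ) := by
      rw [smul_one_eq_diagonal, diagonal_sub]
      rfl
    rw [hdiag, map_sub, map_smul, map_one, ← hA.spectral_theorem]
  have hrank : (A - μ • 1).rank = Finset.card {i | hA.eigenvalues i ≠ μ} := by
    rw [hconj, Unitary.conjStarAlgAut_apply, ← Unitary.coe_star]
    simp [-isUnit_iff_ne_zero, -Unitary.coe_star, rank_diagonal, sub_eq_zero,
      Fintype.card_subtype, Finset.filter_not]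
  have hker : Module.End.eigenspace (toLin' A) μ = LinearMap.ker (toLin' (A - μ • 1)) := by
    rw [Module.End.eigenspace_def, map_sub, map_smul, toLin'_one]
    rfl
  have hnull := LinearMap.finrank_range_add_finrank_ker (toLin' (A - μ • 1))
  have hcard := Finset.card_filter_add_card_filter_not (s := (Finset.univ : Finset ι))
    (fun i => hA.eigenvalues i = μ)
  rw [Module.finrank_fintype_fun_eq_card, ← hker] at hnull
  change (A - μ • 1).rank + _ = _ at hnull
  rw [Finset.card_univ] at hcard
  simp only [ne_eq] at hrank
  omega

end Matrix.IsHermitian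

section ZeroSum

variable {ι : Type*} [Fintype ι] {x : ι → ℝ}

theorem card_mul_sq_le_of_sum_eq_zero (h₁ : ∑ i, x i = 0) (i : ι) :
    (Fintype.card ι : ℝ) * x i ^ 2 ≤ ((Fintype.card ι : ℝ) - 1) * ∑ j, x j ^ 2 := by
  classical
  have hcs := sq_sum_le_card_mul_sum_sq (s := Finset.univ.erase i) (f := x)
  have hsum := Finset.add_sum_erase Finset.univ x (Finset.mem_univ i)
  have hsq := Finset.add_sum_erase Finset.univ (fun j => x j ^ 2) (Finset.mem_univ i)
  have hpos : 1 ≤ Fintype.card ι := Fintype.card_pos_iff.mpr ⟨i⟩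
  rw [Finset.card_erase_of_mem (Finset.mem_univ i), Finset.card_univ, Nat.cast_sub hpos,
    Nat.cast_one, show ∑ j ∈ Finset.univ.erase i, x j = -x i by linarith,
    show ∑ j ∈ Finset.univ.erase i, x j ^ 2 = ∑ j, x j ^ 2 - x i ^ 2 by linarith] at hcs
  linarith

theorem eq_or_eq_of_sum_pow_three_extremal {a : ℝ} (ha : 0 < a) (h₁ : ∑ i, x i = 0)
    (h₂ : ∑ i, x i ^ 2 = (Fintype.card ι : ℝ) * ((Fintype.card ι : ℝ) - 1) * a ^ 2)
    (h₃ : ∑ i, x i ^ 3 =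
      -(((Fintype.card ι : ℝ) - 2) * ((Fintype.card ι : ℝ) * ((Fintype.card ι : ℝ) - 1)) * a ^ 3))
    (i : ι) : x i = a ∨ x i = -((Fintype.card ι : ℝ) - 1) * a := by
  set N : ℝ := (Fintype.card ι : ℝ)
  have hN : 1 ≤ N := Nat.one_le_cast.mpr (Fintype.card_pos_iff.mpr ⟨i⟩)
  have hlow (j : ι) : 0 ≤ x j + (N - 1) * a := by
    have hle := card_mul_sq_le_of_sum_eq_zero h₁ j
    rw [h₂] at hle
    have hsq : x j ^ 2 ≤ ((N - 1) * a) ^ 2 := by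
      refine le_of_mul_le_mul_left (hle.trans_eq ?_) (by linarith : 0 < N)
      ring
    linarith [(abs_le_of_sq_le_sq' hsq (mul_nonneg (by linarith) ha.le)).1]
  have hzero : ∑ j, (x j + (N - 1) * a) * (x j - a) ^ 2 = 0 := by
    have hexp (j : ι) : (x j + (N - 1) * a) * (x j - a) ^ 2 =
        x j ^ 3 + (N - 3) * a * x j ^ 2 + (3 - 2 * N) * a ^ 2 * x j + (N - 1) * a ^ 3 := by
      ring
    simp only [hexp, Finset.sum_add_distrib, ← Finset.mul_sum, h₁, h₂, h₃, Finset.sum_const,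
      Finset.card_univ, nsmul_eq_mul]
    ring
  have hi := (Finset.sum_eq_zero_iff_of_nonneg
    fun j _ => mul_nonneg (hlow j) (sq_nonneg (x j - a))).mp hzero i (Finset.mem_univ i)
  rcases mul_eq_zero.mp hi with h | h
  · right
    linarith
  · left
    exact sub_eq_zero.mp (pow_eq_zero_iff two_ne_zero |>.mp h)

theorem card_eq_one_of_sum_eq_zero {a : ℝ} (ha : 0 < a) [Nonempty ι] (h₁ : ∑ i, x i = 0)
    (h : ∀ i, x i = a ∨ x i = -((Fintype.card ι : ℝ) - 1) * a) :
    Finset.card {i | x i = -((Fintype.card ι : ℝ) - 1) * a} = 1 := by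
  set N : ℝ := (Fintype.card ι : ℝ) with hNdef
  have hN : 0 < N := Nat.cast_pos.mpr Fintype.card_pos
  have hval (i : ι) : x i = a - if x i = -(N - 1) * a then N * a else 0 := by
    split_ifs with hi
    · rw [hi]
      ring
    · rw [sub_zero]
      exact (h i).resolve_right hi
  rw [Finset.sum_congr rfl fun i _ => hval i, Finset.sum_sub_distrib, ← Finset.sum_filter,
    Finset.sum_const, Finset.sum_const, Finset.card_univ, nsmul_eq_mul, nsmul_eq_mul,
    ← hNdef] at h₁
  have hNa : N * a ≠ 0 := by positivity
  exact_mod_cast mul_right_cancel₀ hNa (by linarith :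
    ((Finset.card {i | x i = -(N - 1) * a} : ℕ) : ℝ) * (N * a) = 1 * (N * a))

end ZeroSum

/-- Rigidity in Huisken's estimate: a nonzero trace-free real symmetric `n × n` matrix
(`n ≥ 3`) attaining `tr (T³) = -((n-2)/√(n(n-1))) ‖T‖³` has exactly two distinct
eigenvalues: some `a > 0` with multiplicity `n - 1`, and `-(n-1)a` with multiplicity `1`. -/
theorem stmt_2 (n : ℕ) (hn : 3 ≤ n) (T : Matrix (Fin n) (Fin n) ℝ)
    (hsymm : T.IsSymm) (htr : T.trace = 0) (hT : T ≠ 0)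
    (hext : (T * T * T).trace =
      -(((n : ℝ) - 2) / Real.sqrt ((n : ℝ) * ((n : ℝ) - 1))) *
        Real.sqrt (∑ i, ∑ j, T i j ^ 2) ^ 3) :
    ∃ a : ℝ, 0 < a ∧
      spectrum ℝ T = {a, -((n : ℝ) - 1) * a} ∧
      Module.finrank ℝ (Module.End.eigenspace (Matrix.toLin' T) a) = n - 1 ∧
      Module.finrank ℝ (Module.End.eigenspace (Matrix.toLin' T) (-((n : ℝ) - 1) * a)) = 1 := by
  have hA : T.IsHermitian := by
    rwa [Matrix.IsHermitian, Matrix.conjTranspose_eq_transpose_of_trivial]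
  have hn3 : (3 : ℝ) ≤ n := by exact_mod_cast hn
  have : Nonempty (Fin n) := ⟨⟨0, by omega⟩⟩
  set S := ∑ i, ∑ j, T i j ^ 2 with hS
  have hq : 0 < (n : ℝ) * ((n : ℝ) - 1) := mul_pos (by linarith) (by linarith)
  have hSpos : 0 < S := by
    refine (Finset.sum_nonneg fun i _ => Finset.sum_nonneg fun j _ => sq_nonneg _).lt_of_ne' ?_
    contrapose! hT
    ext i j
    have hrow := (Finset.sum_eq_zero_iff_of_nonneg
      fun i _ => Finset.sum_nonneg fun j _ => sq_nonneg (T i j)).mp hT i (Finset.mem_univ i)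
    have hij := (Finset.sum_eq_zero_iff_of_nonneg
      fun j _ => sq_nonneg (T i j)).mp hrow j (Finset.mem_univ j)
    simpa using hij
  have htrace_sq : (T ^ 2).trace = S := by
    simp only [pow_two, Matrix.trace, Matrix.diag_apply, Matrix.mul_apply, hS]
    exact Finset.sum_congr rfl fun i _ => Finset.sum_congr rfl fun j _ => by rw [hsymm.apply i j]
  set r := Real.sqrt ((n : ℝ) * ((n : ℝ) - 1))
  have hrpos : 0 < r := Real.sqrt_pos.mpr hq
  have hrsq : r ^ 2 = (n : ℝ) * ((n : ℝ) - 1) := Real.sq_sqrt hq.le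
  obtain ⟨a, ha, hSa⟩ : ∃ a, 0 < a ∧ Real.sqrt S = r * a :=
    ⟨Real.sqrt S / r, div_pos (Real.sqrt_pos.mpr hSpos) hrpos, by field_simp⟩
  have h₁ : ∑ i, hA.eigenvalues i = 0 := by
    simpa [htr] using hA.trace_eq_sum_eigenvalues.symm
  have h₂ : ∑ i, hA.eigenvalues i ^ 2 = (n : ℝ) * ((n : ℝ) - 1) * a ^ 2 := by
    rw [← hA.trace_pow_eq_sum_eigenvalues_pow, htrace_sq, ← Real.sq_sqrt hSpos.le, hSa, mul_pow,
      hrsq]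
  have h₃ : ∑ i, hA.eigenvalues i ^ 3 =
      -(((n : ℝ) - 2) * ((n : ℝ) * ((n : ℝ) - 1)) * a ^ 3) := by
    rw [← hA.trace_pow_eq_sum_eigenvalues_pow, pow_three', hext, hSa, ← hrsq]
    field_simp
  have hval (i : Fin n) :
      hA.eigenvalues i = a ∨ hA.eigenvalues i = -((n : ℝ) - 1) * a := by
    simpa only [Fintype.card_fin] using
      eq_or_eq_of_sum_pow_three_extremal ha h₁ (by simpa only [Fintype.card_fin] using h₂)
        (by simpa only [Fintype.card_fin] using h₃) i
  have hone : Finset.card {i | hA.eigenvalues i = -((n : ℝ) - 1) * a} = 1 := by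
    simpa only [Fintype.card_fin] using
      card_eq_one_of_sum_eq_zero ha h₁ (by simpa only [Fintype.card_fin] using hval)
  have hne : a ≠ -((n : ℝ) - 1) * a := by nlinarith
  have hrest : Finset.card {i | hA.eigenvalues i = a} = n - 1 := by
    have hcard := Finset.card_filter_add_card_filter_not (s := (Finset.univ : Finset (Fin n)))
      (fun i => hA.eigenvalues i = -((n : ℝ) - 1) * a)
    have hiff (i : Fin n) : ¬hA.eigenvalues i = -((n : ℝ) - 1) * a ↔ hA.eigenvalues i = a :=
      ⟨(hval i).resolve_right, fun h h' => hne (h.symm.trans h')⟩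
    simp only [hiff] at hcard
    rw [hone, Finset.card_univ, Fintype.card_fin] at hcard
    omega
  refine ⟨a, ha, ?_, (hA.finrank_eigenspace_toLin' a).trans hrest,
    (hA.finrank_eigenspace_toLin' _).trans hone⟩
  rw [hA.spectrum_real_eq_range_eigenvalues]
  refine Set.Subset.antisymm (Set.range_subset_iff.mpr hval) ?_
  rintro _ (rfl | rfl)
  · obtain ⟨i, hi⟩ := Finset.card_pos.mp (hrest ▸ (by omega : 0 < n - 1))
    exact ⟨i, (Finset.mem_filter.mp hi).2⟩
  · obtain ⟨i, hi⟩ := Finset.card_pos.mp (hone ▸ one_pos)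
    exact ⟨i, (Finset.mem_filter.mp hi).2⟩
end

section
/- Let n ≥ 3 and let T be a 4-tensor on ℝⁿ which has the algebraic symmetries of the Riemann curvature tensor (T_{ijkl} = T_{klij} = −T_{jikl} = −T_{ijlk}), satisfies the first Bianchi identity (T_{ijkl} + T_{iljk} + T_{iklj} = 0), and has vanishing total trace (Σ_{i,j} T_{ijij} = 0). Then |2 Σ T_{ijlk} T_{ihlm} T_{hjmk} + (1/2) Σ T_{ijkl} T_{ijhm} T_{hmkl}| ≤ ( 2(n²−2)/(n√(n²−1)) + (n²−n−4)/(2√((n−2)n(n²−1))) ) · ‖T‖³, where all sums run over all repeated indices in {1,…,n} and ‖T‖² = Σ_{i,j,k,l} T_{ijkl}². -/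
open Finset in
/-- Sharp bound for the sum of cubes of real numbers with vanishing sum, one-sided version. -/
theorem sum_cube_le_of_sum_eq_zero {ι : Type*} [Fintype ι] (hN : 2 ≤ Fintype.card ι)
    (x : ι → ℝ) (hx : ∑ i, x i = 0) :
    ∑ i, x i ^ 3 ≤ ((Fintype.card ι : ℝ) - 2) /
      √((Fintype.card ι : ℝ) * ((Fintype.card ι : ℝ) - 1)) * √(∑ i, x i ^ 2) ^ 3 := by
  classical
  have hN' : (2 : ℝ) ≤ Fintype.card ι := by exact_mod_cast hN
  set N := (Fintype.card ι : ℝ) with hNdef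
  set s := √(∑ i, x i ^ 2) with hs
  set d := √(N * (N - 1)) with hd
  have hd0 : 0 < d := Real.sqrt_pos.2 (by nlinarith)
  have hd2 : d ^ 2 = N * (N - 1) := Real.sq_sqrt (by nlinarith)
  have hs0 : 0 ≤ s := Real.sqrt_nonneg _
  have hs2 : s ^ 2 = ∑ i, x i ^ 2 := Real.sq_sqrt (sum_nonneg fun i _ => sq_nonneg _)
  have hle : ∀ i, d * x i ≤ (N - 1) * s := by
    intro i
    have h1 : (∑ j ∈ univ.erase i, x j) = -x i := by
      have := add_sum_erase univ x (mem_univ i)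
      linarith
    have h2 : x i ^ 2 + ∑ j ∈ univ.erase i, x j ^ 2 = s ^ 2 := by
      rw [hs2]; exact add_sum_erase univ (fun j => x j ^ 2) (mem_univ i)
    have h3 := sq_sum_le_card_mul_sum_sq (s := univ.erase i) (f := x)
    have h4 : ((#(univ.erase i) : ℕ) : ℝ) = N - 1 := by
      rw [card_erase_of_mem (mem_univ i), card_univ, Nat.cast_sub (by omega)]; simp [hNdef]
    rw [h1, h4] at h3
    refine abs_le_of_sq_le_sq' ?_ (by nlinarith) |>.2
    rw [mul_pow, hd2, mul_pow, ← h2]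
    nlinarith
  have hnonneg : 0 ≤ ∑ i, (d * x i + s) ^ 2 * ((N - 1) * s - d * x i) :=
    sum_nonneg fun i _ => mul_nonneg (sq_nonneg _) (sub_nonneg.2 (hle i))
  have hexp : ∑ i, (d * x i + s) ^ 2 * ((N - 1) * s - d * x i) =
      -d ^ 3 * ∑ i, x i ^ 3 + (N - 3) * s * d ^ 2 * ∑ i, x i ^ 2
        + (2 * N - 3) * s ^ 2 * d * ∑ i, x i + N * ((N - 1) * s ^ 3) := by
    have hc : N * ((N - 1) * s ^ 3) = ∑ _i : ι, (N - 1) * s ^ 3 := by simp [hNdef]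
    rw [hc]
    simp only [mul_sum, ← sum_add_distrib]
    exact sum_congr rfl fun i _ => by ring
  rw [hexp, hx, ← hs2] at hnonneg
  have hmain : 0 ≤ d ^ 2 * ((N - 2) * s ^ 3 - d * ∑ i, x i ^ 3) := by
    calc (0 : ℝ) ≤ _ := hnonneg
      _ = d ^ 2 * ((N - 3) * s ^ 3 - d * ∑ i, x i ^ 3) + (N * (N - 1)) * s ^ 3 := by ring
      _ = _ := by rw [← hd2]; ring
  have := nonneg_of_mul_nonneg_right hmain (by positivity)
  rw [div_mul_eq_mul_div, le_div_iff₀ hd0]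
  linarith

/-- Sharp bound for the sum of cubes of real numbers with vanishing sum. -/
theorem abs_sum_cube_le_of_sum_eq_zero {ι : Type*} [Fintype ι] (hN : 2 ≤ Fintype.card ι)
    (x : ι → ℝ) (hx : ∑ i, x i = 0) :
    |∑ i, x i ^ 3| ≤ ((Fintype.card ι : ℝ) - 2) /
      √((Fintype.card ι : ℝ) * ((Fintype.card ι : ℝ) - 1)) * √(∑ i, x i ^ 2) ^ 3 := by
  refine abs_le'.2 ⟨sum_cube_le_of_sum_eq_zero hN x hx, ?_⟩
  have h := sum_cube_le_of_sum_eq_zero hN (fun i => -x i) (by simp [hx])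
  simpa [Odd.neg_pow (by decide : Odd 3)] using h

/-- The trace of a power of a real symmetric matrix is the power sum of its eigenvalues. -/
theorem Matrix.IsHermitian.trace_pow_eq_sum_eigenvalues_pow_s4 {ι : Type*} [Fintype ι]
    [DecidableEq ι] {A : Matrix ι ι ℝ} (hA : A.IsHermitian) (k : ℕ) :
    (A ^ k).trace = ∑ i, hA.eigenvalues i ^ k := by
  conv_lhs => rw [hA.spectral_theorem, ← map_pow, Matrix.diagonal_pow,
    Unitary.conjStarAlgAut_apply, Matrix.trace_mul_cycle]
  simp [Matrix.trace_diagonal]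

/-- Sharp cubic trace estimate for a trace-free real symmetric matrix, in coordinates. -/
theorem abs_sum_cyclic_cube_le_of_trace_eq_zero {ι : Type*} [Fintype ι]
    (hN : 2 ≤ Fintype.card ι) (M : ι → ι → ℝ) (hM : ∀ i j, M i j = M j i)
    (htr : ∑ i, M i i = 0) :
    |∑ i, ∑ j, ∑ k, M i j * M j k * M k i| ≤ ((Fintype.card ι : ℝ) - 2) /
      √((Fintype.card ι : ℝ) * ((Fintype.card ι : ℝ) - 1)) * √(∑ i, ∑ j, M i j ^ 2) ^ 3 := by
  classical
  have hA : (Matrix.of M).IsHermitian := Matrix.IsHermitian.ext fun i j => by simp [hM i j]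
  have h1 := hA.trace_pow_eq_sum_eigenvalues_pow_s4 1
  have h2 := hA.trace_pow_eq_sum_eigenvalues_pow_s4 2
  have h3 := hA.trace_pow_eq_sum_eigenvalues_pow_s4 3
  have h := abs_sum_cube_le_of_sum_eq_zero hN hA.eigenvalues
    (by simpa [Matrix.trace, htr] using h1.symm)
  rw [← h2, ← h3] at h
  convert h using 2
  · simp only [pow_succ, pow_zero, one_mul, Matrix.trace, Matrix.diag, Matrix.mul_apply,
      Matrix.of_apply, Finset.sum_mul]
    exact Finset.sum_congr rfl fun i _ => Finset.sum_comm
  · congr 2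
    simp only [pow_two, Matrix.trace, Matrix.diag, Matrix.mul_apply, Matrix.of_apply]
    exact Finset.sum_congr rfl fun i _ => Finset.sum_congr rfl fun j _ => by rw [hM j i]

/-- A symmetric double sum with zero diagonal is twice the sum over increasing pairs. -/
theorem sum_sum_eq_two_mul_sum_lt {α : Type*} [Fintype α] [LinearOrder α] (f : α → α → ℝ)
    (hf : ∀ i j, f i j = f j i) (hf0 : ∀ i, f i i = 0) :
    ∑ i, ∑ j, f i j = 2 * ∑ p : {p : α × α // p.1 < p.2}, f p.1.1 p.1.2 := by
  have hlt : ∑ p : {p : α × α // p.1 < p.2}, f p.1.1 p.1.2 =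
      ∑ i, ∑ j, if i < j then f i j else 0 := by
    rw [← Fintype.sum_prod_type' (f := fun i j => if i < j then f i j else 0),
      ← Finset.sum_filter]
    exact (Finset.sum_subtype _ (by simp) fun p : α × α => f p.1 p.2).symm
  have hgt : ∑ i, ∑ j, (if i < j then f i j else 0) =
      ∑ i, ∑ j, if j < i then f i j else 0 := by
    rw [Finset.sum_comm]
    exact Finset.sum_congr rfl fun i _ => Finset.sum_congr rfl fun j _ => by rw [hf]
  rw [hlt, two_mul]
  nth_rewrite 2 [hgt]
  simp only [← Finset.sum_add_distrib]
  refine Finset.sum_congr rfl fun i _ => Finset.sum_congr rfl fun j _ => ?_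
  rcases lt_trichotomy i j with h | rfl | h
  · simp [h, h.not_gt]
  · simp [hf0]
  · simp [h, h.not_gt]

/-- The number of increasing pairs in `Fin n` is `n (n - 1) / 2`. -/
theorem two_mul_card_increasing_pairs (n : ℕ) :
    2 * (Fintype.card {p : Fin n × Fin n // p.1 < p.2} : ℝ) = n * (n - 1) := by
  have h := sum_sum_eq_two_mul_sum_lt (fun i j : Fin n => if i = j then (0 : ℝ) else 1)
    (fun i j => by simp [eq_comm]) (by simp)
  have hp : ∀ p : {p : Fin n × Fin n // p.1 < p.2},
      (if p.1.1 = p.1.2 then (0 : ℝ) else 1) = 1 := fun p => if_neg p.2.ne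
  have hi : ∀ i j : Fin n, (if i = j then (0 : ℝ) else 1) = 1 - if i = j then 1 else 0 :=
    fun i j => by split_ifs <;> simp
  simp only [hp] at h
  simp only [hi, Finset.sum_sub_distrib] at h
  simp at h
  rw [← h]; ring

/-- The cubic trace estimate on `2`-tensors. -/
theorem abs_sum_cube_two_tensors_le (n : ℕ) (hn : 3 ≤ n)
    (T : Fin n → Fin n → Fin n → Fin n → ℝ)
    (hanti1 : ∀ i j k l, T i j k l = -T j i k l)
    (hanti2 : ∀ i j k l, T i j k l = -T i j l k) :
    |∑ i, ∑ j, ∑ l, ∑ k, ∑ h, ∑ m, T i j l k * T i h l m * T h j m k| ≤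
      ((n : ℝ) ^ 2 - 2) / (n * √((n : ℝ) ^ 2 - 1)) *
        √(∑ i, ∑ j, ∑ k, ∑ l, T i j k l ^ 2) ^ 3 := by
  have hanti : ∀ i j k l, T i j k l = T j i l k := fun i j k l => by
    rw [hanti1, hanti2, neg_neg]
  have hdiag : ∀ i k l, T i i k l = 0 := fun i k l => by linarith [hanti1 i i k l]
  have key := abs_sum_cyclic_cube_le_of_trace_eq_zero (ι := Fin n × Fin n)
    (by simp; nlinarith) (fun p q => T p.1 q.1 p.2 q.2) (fun p q => hanti _ _ _ _)
    (by simp [hdiag])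
  simp only [Fintype.sum_prod_type, Fintype.card_prod, Fintype.card_fin, Nat.cast_mul] at key
  have hsq : √((n : ℝ) * n * (n * n - 1)) = n * √((n : ℝ) ^ 2 - 1) := by
    rw [Real.sqrt_mul (by positivity), Real.sqrt_mul_self (by positivity), pow_two]
  rw [hsq, ← pow_two] at key
  convert key using 2
  · refine Finset.sum_congr rfl fun i _ => ?_
    rw [Finset.sum_comm]
    refine Finset.sum_congr rfl fun l _ => Finset.sum_congr rfl fun j _ =>
      Finset.sum_congr rfl fun k _ => Finset.sum_congr rfl fun h _ =>
      Finset.sum_congr rfl fun m _ => ?_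
    rw [hanti i h l m, hanti h j m k]; ring
  · congr 2
    exact Finset.sum_congr rfl fun i _ => Finset.sum_comm

/-- The cubic trace estimate on skew-symmetric `2`-tensors. -/
theorem abs_sum_cube_skew_two_tensors_le (n : ℕ) (hn : 3 ≤ n)
    (T : Fin n → Fin n → Fin n → Fin n → ℝ)
    (hpair : ∀ i j k l, T i j k l = T k l i j)
    (hanti1 : ∀ i j k l, T i j k l = -T j i k l)
    (hanti2 : ∀ i j k l, T i j k l = -T i j l k)
    (htrace : ∑ i, ∑ j, T i j i j = 0) :
    |∑ i, ∑ j, ∑ k, ∑ l, ∑ h, ∑ m, T i j k l * T i j h m * T h m k l| ≤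
      ((n : ℝ) ^ 2 - n - 4) / √(((n : ℝ) - 2) * n * ((n : ℝ) ^ 2 - 1)) *
        √(∑ i, ∑ j, ∑ k, ∑ l, T i j k l ^ 2) ^ 3 := by
  have hdiag1 : ∀ i k l, T i i k l = 0 := fun i k l => by linarith [hanti1 i i k l]
  have hdiag2 : ∀ i j k, T i j k k = 0 := fun i j k => by linarith [hanti2 i j k k]
  have hn' : (3 : ℝ) ≤ n := by exact_mod_cast hn
  have hcard := two_mul_card_increasing_pairs n
  set N := (Fintype.card {p : Fin n × Fin n // p.1 < p.2} : ℝ) with hN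
  have hNval : N = n * (n - 1) / 2 := by linarith
  have hN2 : 2 ≤ N := by rw [hNval]; nlinarith
  have htr : ∑ p : {p : Fin n × Fin n // p.1 < p.2}, 2 * T p.1.1 p.1.2 p.1.1 p.1.2 = 0 := by
    rw [← Finset.mul_sum, ← sum_sum_eq_two_mul_sum_lt (fun i j => T i j i j)
      (fun i j => by rw [hanti1, hanti2, neg_neg]) (fun i => hdiag1 _ _ _), htrace]
  have key := abs_sum_cyclic_cube_le_of_trace_eq_zero (ι := {p : Fin n × Fin n // p.1 < p.2})
    (by rw [hN] at hN2; exact_mod_cast hN2)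
    (fun p q => 2 * T p.1.1 p.1.2 q.1.1 q.1.2) (fun p q => by rw [hpair]) htr
  rw [← hN] at key
  have hsq : √(N * (N - 1)) = √(((n : ℝ) - 2) * n * ((n : ℝ) ^ 2 - 1)) / 2 := by
    rw [eq_div_iff (by norm_num), ← Real.sqrt_sq (by norm_num : (0 : ℝ) ≤ 2),
      ← Real.sqrt_mul (by nlinarith), hNval]
    congr 1; simp; ring
  have hcoef : (N - 2) / √(N * (N - 1)) =
      ((n : ℝ) ^ 2 - n - 4) / √(((n : ℝ) - 2) * n * ((n : ℝ) ^ 2 - 1)) := by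
    rw [hsq, ← mul_div_mul_right (N - 2) _ (two_ne_zero (α := ℝ)), div_mul_cancel₀ _ two_ne_zero,
      hNval]
    congr 1; ring
  rw [hcoef] at key
  convert key using 2
  · rw [sum_sum_eq_two_mul_sum_lt
      (fun i j => ∑ k, ∑ l, ∑ h, ∑ m, T i j k l * T i j h m * T h m k l)
      (fun i j => by simp only [hanti1 j i, neg_mul_neg]) (fun i => by simp [hdiag1]),
      Finset.mul_sum]
    refine Finset.sum_congr rfl fun p _ => ?_
    rw [sum_sum_eq_two_mul_sum_lt
      (fun k l => ∑ h, ∑ m, T p.1.1 p.1.2 k l * T p.1.1 p.1.2 h m * T h m k l)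
      (fun k l => by simp only [hanti2 _ _ l k]; simp) (fun i => by simp [hdiag2]),
      ← mul_assoc, Finset.mul_sum]
    refine Finset.sum_congr rfl fun q _ => ?_
    rw [sum_sum_eq_two_mul_sum_lt
      (fun h m => T p.1.1 p.1.2 q.1.1 q.1.2 * T p.1.1 p.1.2 h m * T h m q.1.1 q.1.2)
      (fun h m => by rw [hanti2 _ _ h m, hanti1 h m]; ring) (fun i => by simp [hdiag2]),
      ← mul_assoc, Finset.mul_sum]
    refine Finset.sum_congr rfl fun r _ => ?_
    rw [hpair q.1.1, hpair r.1.1 r.1.2 p.1.1]; ring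
  · congr 2
    rw [sum_sum_eq_two_mul_sum_lt (fun i j => ∑ k, ∑ l, T i j k l ^ 2)
      (fun i j => by simp only [hanti1 j i, neg_sq]) (fun i => by simp [hdiag1]),
      Finset.mul_sum]
    refine Finset.sum_congr rfl fun p _ => ?_
    rw [sum_sum_eq_two_mul_sum_lt (fun k l => T p.1.1 p.1.2 k l ^ 2)
      (fun k l => by rw [hanti2 _ _ k l, neg_sq]) (fun i => by simp [hdiag2]),
      ← mul_assoc, Finset.mul_sum]
    exact Finset.sum_congr rfl fun q _ => by ring


/-- Inequality (2.11): for a 4-tensor `T` on `ℝⁿ` (`n ≥ 3`) with the algebraic symmetries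
of the Riemann curvature tensor, the first Bianchi identity, and vanishing total trace,
`|2 ∑ T_{ijlk}T_{ihlm}T_{hjmk} + (1/2) ∑ T_{ijkl}T_{ijhm}T_{hmkl}|
  ≤ (2(n²-2)/(n√(n²-1)) + (n²-n-4)/(2√((n-2)n(n²-1)))) ‖T‖³`. -/
theorem stmt_4 (n : ℕ) (hn : 3 ≤ n) (T : Fin n → Fin n → Fin n → Fin n → ℝ)
    (hpair : ∀ i j k l, T i j k l = T k l i j)
    (hanti1 : ∀ i j k l, T i j k l = -T j i k l)
    (hanti2 : ∀ i j k l, T i j k l = -T i j l k)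
    (hbianchi : ∀ i j k l, T i j k l + T i l j k + T i k l j = 0)
    (htrace : ∑ i, ∑ j, T i j i j = 0) :
    |2 * (∑ i, ∑ j, ∑ l, ∑ k, ∑ h, ∑ m, T i j l k * T i h l m * T h j m k) +
        (1 / 2) * (∑ i, ∑ j, ∑ k, ∑ l, ∑ h, ∑ m, T i j k l * T i j h m * T h m k l)| ≤
      (2 * ((n : ℝ) ^ 2 - 2) / ((n : ℝ) * Real.sqrt ((n : ℝ) ^ 2 - 1)) +
          ((n : ℝ) ^ 2 - (n : ℝ) - 4) /
            (2 * Real.sqrt (((n : ℝ) - 2) * (n : ℝ) * ((n : ℝ) ^ 2 - 1)))) *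
        Real.sqrt (∑ i, ∑ j, ∑ k, ∑ l, T i j k l ^ 2) ^ 3 := by
  have h1 := abs_sum_cube_two_tensors_le n hn T hanti1 hanti2
  have h2 := abs_sum_cube_skew_two_tensors_le n hn T hpair hanti1 hanti2 htrace
  refine (abs_add_le _ _).trans ?_
  rw [abs_mul, abs_mul, abs_of_pos (by norm_num : (0 : ℝ) < 2),
    abs_of_pos (by norm_num : (0 : ℝ) < 1 / 2), add_mul]
  refine (add_le_add (mul_le_mul_of_nonneg_left h1 zero_le_two)
    (mul_le_mul_of_nonneg_left h2 (by norm_num : (0 : ℝ) ≤ 1 / 2))).trans_eq ?_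
  rw [← mul_assoc, ← mul_assoc, ← mul_div_assoc, div_mul_div_comm, one_mul]
end

section
/- (Lemma 3.3) Let n ≥ 3, let W be a 4-tensor on ℝⁿ with the algebraic symmetries of the Riemann curvature tensor (W_{ijkl} = W_{klij} = −W_{jikl} = −W_{ijlk}) which is totally trace-free (Σ_i W_{ijil} = 0 for all j,l), and let B be a real symmetric n×n matrix with tr(B) = 0. Then | −Σ_{i,j,k,l} W_{ijkl} B_{ik} B_{jl} + (n/(2(n−2))) tr(B³) | ≤ √((n−2)/(2(n−1))) · ‖B‖² · ( ‖W‖² + (n/(2(n−2))) ‖B‖² )^{1/2}. -/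
open Matrix

/-- The Kulkarni–Nomizu product of two matrices, as a function on quadruples of indices. -/
def kulkarniNomizu {ι : Type*} (A D : Matrix ι ι ℝ) : ι × ι × ι × ι → ℝ := fun p =>
  A p.1 p.2.2.1 * D p.2.1 p.2.2.2 + A p.2.1 p.2.2.2 * D p.1 p.2.2.1 -
    A p.1 p.2.2.2 * D p.2.1 p.2.2.1 - A p.2.1 p.2.2.1 * D p.1 p.2.2.2

section KulkarniNomizu

variable {ι : Type*} [Fintype ι]

theorem dotProduct_kulkarniNomizu (W : ι × ι × ι × ι → ℝ)
    (h₁ : ∀ i j k l, W (i, j, k, l) = -W (j, i, k, l))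
    (h₂ : ∀ i j k l, W (i, j, k, l) = -W (i, j, l, k)) (A D : Matrix ι ι ℝ) :
    W ⬝ᵥ kulkarniNomizu A D = 4 * ∑ i, ∑ j, ∑ k, ∑ l, W (i, j, k, l) * A i k * D j l := by
  have e₂ : ∑ i, ∑ j, ∑ k, ∑ l, W (i, j, k, l) * (A i l * D j k) =
      -∑ i, ∑ j, ∑ k, ∑ l, W (i, j, k, l) * A i k * D j l := by
    simp only [← Finset.sum_neg_distrib]
    refine Finset.sum_congr rfl fun i _ => Finset.sum_congr rfl fun j _ => ?_
    rw [Finset.sum_comm]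
    refine Finset.sum_congr rfl fun k _ => Finset.sum_congr rfl fun l _ => ?_
    rw [h₂]; ring
  have e₁ : ∑ i, ∑ j, ∑ k, ∑ l, W (i, j, k, l) * (A j k * D i l) =
      -∑ i, ∑ j, ∑ k, ∑ l, W (i, j, k, l) * A i k * D j l := by
    rw [Finset.sum_comm]
    simp only [← Finset.sum_neg_distrib]
    refine Finset.sum_congr rfl fun i _ => Finset.sum_congr rfl fun j _ =>
      Finset.sum_congr rfl fun k _ => Finset.sum_congr rfl fun l _ => ?_
    rw [h₁]; ring
  have e₃ : ∑ i, ∑ j, ∑ k, ∑ l, W (i, j, k, l) * (A j l * D i k) =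
      ∑ i, ∑ j, ∑ k, ∑ l, W (i, j, k, l) * A i k * D j l := by
    rw [Finset.sum_comm]
    refine Finset.sum_congr rfl fun i _ => Finset.sum_congr rfl fun j _ => ?_
    rw [Finset.sum_comm]
    refine Finset.sum_congr rfl fun k _ => Finset.sum_congr rfl fun l _ => ?_
    rw [h₁, h₂]; ring
  simp only [dotProduct, kulkarniNomizu, Fintype.sum_prod_type, mul_sub, mul_add,
    Finset.sum_add_distrib, Finset.sum_sub_distrib, e₁, e₂, e₃]
  simp only [mul_assoc]
  ring

theorem kulkarniNomizu_dotProduct_kulkarniNomizu (A D : Matrix ι ι ℝ) {E F : Matrix ι ι ℝ}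
    (hE : E.IsSymm) (hF : F.IsSymm) :
    kulkarniNomizu A D ⬝ᵥ kulkarniNomizu E F =
      4 * ((A * E).trace * (D * F).trace + (A * F).trace * (D * E).trace -
        (A * F * (D * E)).trace - (D * F * (A * E)).trace) := by
  have pairing (P Q R S : Matrix ι ι ℝ) (hR : R.IsSymm) (hS : S.IsSymm) :
      ∑ i, ∑ j, ∑ k, ∑ l, P i k * Q j l * R i k * S j l = (P * R).trace * (Q * S).trace := by
    simp only [trace, diag, mul_apply, Finset.sum_mul_sum]
    refine Finset.sum_congr rfl fun i _ => Finset.sum_congr rfl fun j _ =>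
      Finset.sum_congr rfl fun k _ => Finset.sum_congr rfl fun l _ => ?_
    rw [hR.apply k i, hS.apply l j]; ring
  have cycle (P Q R S : Matrix ι ι ℝ) (hR : R.IsSymm) (hS : S.IsSymm) :
      ∑ i, ∑ j, ∑ k, ∑ l, P i l * Q j k * R i k * S j l = (P * S * (Q * R)).trace := by
    simp only [trace, diag, mul_apply, Finset.sum_mul_sum]
    refine Finset.sum_congr rfl fun i _ => Finset.sum_congr rfl fun j _ => ?_
    rw [Finset.sum_comm]
    refine Finset.sum_congr rfl fun l _ => Finset.sum_congr rfl fun k _ => ?_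
    rw [hR.apply k i, hS.apply l j]; ring
  have pairing' : ∑ i, ∑ j, ∑ k, ∑ l, A j l * D i k * E i k * F j l =
      (A * F).trace * (D * E).trace := by
    rw [mul_comm, ← pairing D A E F hE hF]
    simp only [mul_comm (D _ _) (A _ _)]
  have cycle' : ∑ i, ∑ j, ∑ k, ∑ l, A j k * D i l * E i k * F j l =
      (D * F * (A * E)).trace := by
    rw [← cycle D A E F hE hF]
    simp only [mul_comm (D _ _) (A _ _)]
  rw [dotProduct_kulkarniNomizu _ (fun i j k l => by simp only [kulkarniNomizu]; ring)
    (fun i j k l => by simp only [kulkarniNomizu]; ring)]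
  simp only [kulkarniNomizu, add_mul, sub_mul, Finset.sum_add_distrib, Finset.sum_sub_distrib,
    pairing A D E F hE hF, cycle A D E F hE hF, pairing', cycle']

theorem dotProduct_kulkarniNomizu_one [DecidableEq ι] (W : ι × ι × ι × ι → ℝ)
    (h₁ : ∀ i j k l, W (i, j, k, l) = -W (j, i, k, l))
    (h₂ : ∀ i j k l, W (i, j, k, l) = -W (i, j, l, k))
    (htr : ∀ j l, ∑ i, W (i, j, i, l) = 0) (A : Matrix ι ι ℝ) :
    W ⬝ᵥ kulkarniNomizu A 1 = 0 := by
  have htr' (i k : ι) : ∑ j, W (i, j, k, j) = 0 := by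
    rw [← htr i k]
    refine Finset.sum_congr rfl fun j _ => ?_
    rw [h₁, h₂, neg_neg]
  rw [dotProduct_kulkarniNomizu W h₁ h₂]
  refine mul_eq_zero_of_right _ (Finset.sum_eq_zero fun i _ => ?_)
  rw [Finset.sum_comm]
  refine Finset.sum_eq_zero fun k _ => ?_
  simp [one_apply, ← Finset.sum_mul, htr']

theorem dotProduct_sq_le (X Y : ι → ℝ) : (X ⬝ᵥ Y) ^ 2 ≤ X ⬝ᵥ X * (Y ⬝ᵥ Y) := by
  simpa only [dotProduct, sq] using Finset.sum_mul_sq_le_sq_mul_sq Finset.univ X Y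

end KulkarniNomizu


/-- Lemma 3.3: for a totally trace-free curvature-type 4-tensor `W` on `ℝⁿ` (`n ≥ 3`) and a
symmetric trace-free matrix `B`,
`|-∑ W_{ijkl} B_{ik} B_{jl} + (n/(2(n-2))) tr(B³)|
  ≤ √((n-2)/(2(n-1))) ‖B‖² (‖W‖² + (n/(2(n-2))) ‖B‖²)^(1/2)`. -/
theorem stmt_8 (n : ℕ) (hn : 3 ≤ n) (W : Fin n → Fin n → Fin n → Fin n → ℝ)
    (hpair : ∀ i j k l, W i j k l = W k l i j)
    (hanti1 : ∀ i j k l, W i j k l = -W j i k l)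
    (hanti2 : ∀ i j k l, W i j k l = -W i j l k)
    (htracefree : ∀ j l, ∑ i, W i j i l = 0)
    (B : Matrix (Fin n) (Fin n) ℝ) (hB : B.IsSymm) (htr : B.trace = 0) :
    |-(∑ i, ∑ j, ∑ k, ∑ l, W i j k l * B i k * B j l) +
        ((n : ℝ) / (2 * ((n : ℝ) - 2))) * (B * B * B).trace| ≤
      Real.sqrt (((n : ℝ) - 2) / (2 * ((n : ℝ) - 1))) * (∑ i, ∑ j, B i j ^ 2) *
        Real.sqrt ((∑ i, ∑ j, ∑ k, ∑ l, W i j k l ^ 2) +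
          ((n : ℝ) / (2 * ((n : ℝ) - 2))) * (∑ i, ∑ j, B i j ^ 2)) := by
  have hn' : (3 : ℝ) ≤ n := by exact_mod_cast hn
  have hn0 : (n : ℝ) ≠ 0 := by linarith
  have hn1 : (n : ℝ) - 1 ≠ 0 := by linarith
  have hn2 : (n : ℝ) - 2 ≠ 0 := by linarith
  have hC : (B * B).IsSymm := by rw [IsSymm, transpose_mul, hB]
  have h1 : (1 : Matrix (Fin n) (Fin n) ℝ).IsSymm := isSymm_one
  have hb : ∑ i, ∑ j, B i j ^ 2 = (B * B).trace := by
    simp only [trace, diag, mul_apply]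
    refine Finset.sum_congr rfl fun i _ => Finset.sum_congr rfl fun j _ => ?_
    rw [hB.apply i j, sq]
  have hb0 : 0 ≤ (B * B).trace := hb ▸ by positivity
  rw [hb]
  set w : Fin n × Fin n × Fin n × Fin n → ℝ := fun p => W p.1 p.2.1 p.2.2.1 p.2.2.2 with hw
  have hww : ∑ i, ∑ j, ∑ k, ∑ l, W i j k l ^ 2 = w ⬝ᵥ w := by
    simp only [dotProduct, Fintype.sum_prod_type, hw, sq]
  have hwB : w ⬝ᵥ kulkarniNomizu B B = 4 * ∑ i, ∑ j, ∑ k, ∑ l, W i j k l * B i k * B j l :=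
    dotProduct_kulkarniNomizu w hanti1 hanti2 B B
  have hw1 := dotProduct_kulkarniNomizu_one w hanti1 hanti2 htracefree
  have hT : (1 : Matrix (Fin n) (Fin n) ℝ).trace = n := by simp
  obtain ⟨σ, hσ⟩ : ∃ σ : ℝ, σ ^ 2 = n / 2 := ⟨√(n / 2), Real.sq_sqrt (by positivity)⟩
  set c : ℝ := σ / (2 * (n - 2)) with hc
  set p : ℝ := -(σ - 1) / (2 * (n - 2)) with hp
  set b : ℝ := (B * B).trace with hbdef
  set r : ℝ := b / (4 * n * (n - 1)) + (σ - 1) * b / (2 * n * (n - 2)) with hr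
  set X := (1 / 4 : ℝ) • kulkarniNomizu B B + p • kulkarniNomizu (B * B) 1 +
    r • kulkarniNomizu (1 : Matrix (Fin n) (Fin n) ℝ) 1 with hX
  set Y := w + c • kulkarniNomizu B 1 with hY
  have hXY : Y ⬝ᵥ X = (∑ i, ∑ j, ∑ k, ∑ l, W i j k l * B i k * B j l) -
      n / (2 * (n - 2)) * (B * B * B).trace := by
    simp only [hX, hY, add_dotProduct, dotProduct_add, smul_dotProduct, dotProduct_smul,
      smul_eq_mul, hwB, hw1, kulkarniNomizu_dotProduct_kulkarniNomizu _ _ hB hB,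
      kulkarniNomizu_dotProduct_kulkarniNomizu _ _ hC h1,
      kulkarniNomizu_dotProduct_kulkarniNomizu _ _ h1 h1, mul_one, one_mul, ← Matrix.mul_assoc,
      htr, hT]
    rw [hp, hc]
    field_simp
    linear_combination -(4 * (B * B * B).trace * (n - 2)) * hσ
  have hYY : Y ⬝ᵥ Y = w ⬝ᵥ w + n / (2 * (n - 2)) * b := by
    simp only [hY, add_dotProduct, dotProduct_add, smul_dotProduct, dotProduct_smul,
      smul_eq_mul, dotProduct_comm _ w, hw1, kulkarniNomizu_dotProduct_kulkarniNomizu _ _ hB h1,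
      mul_one, one_mul, htr, hT, ← hbdef]
    rw [hc]
    field_simp
    linear_combination 4 * b * (n - 2) * hσ
  have hXX : X ⬝ᵥ X = (n - 2) / (2 * (n - 1)) * b ^ 2 := by
    simp only [hX, add_dotProduct, dotProduct_add, smul_dotProduct, dotProduct_smul,
      smul_eq_mul, kulkarniNomizu_dotProduct_kulkarniNomizu _ _ hB hB,
      kulkarniNomizu_dotProduct_kulkarniNomizu _ _ hC h1,
      kulkarniNomizu_dotProduct_kulkarniNomizu _ _ h1 h1, mul_one, one_mul, ← Matrix.mul_assoc,
      htr, hT, ← hbdef]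
    rw [hr, hp]
    field_simp
    linear_combination (b ^ 2 * (-80 * n + 64 * n ^ 2 - 16 * n ^ 3 + 32) +
      (B * B * B * B).trace * (-32 * n + 80 * n ^ 2 - 64 * n ^ 3 + 16 * n ^ 4)) * hσ
  have hcs := dotProduct_sq_le Y X
  rw [hXY, hYY, hXX] at hcs
  have hk : 0 ≤ ((n : ℝ) - 2) / (2 * (n - 1)) := by apply div_nonneg <;> linarith
  rw [hww, ← Real.sqrt_sq hb0, ← Real.sqrt_mul hk,
    ← Real.sqrt_mul (mul_nonneg hk (sq_nonneg b))]
  apply Real.abs_le_sqrt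
  rw [Real.sqrt_sq hb0]
  linarith
end
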